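/- Let k ≥ 1 and t = (k² + 3k)/2. For every positive arc-weighting w of the complete digraph on t vertices, there exist k pairwise vertex-disjoint directed cycles C_1, ..., C_k whose total weights are pairwise distinct. -/

import Mathlib

/-- A directed cycle of length `n` in the digraph with arc relation `A`. -/
def IsDicycle {V : Type*} (A : V → V → Prop) (n : ℕ) (c : ℕ → V) : Prop :=
  2 ≤ n ∧ (∀ i, A (c i) (c (i + 1))) ∧ (∀ i, c (i + n) = c i) ∧
    ∀ i j, i < n → j < n → c i = c j → i = j

/-- Enumeration of a finset, starting at a root, sorted by weight back to the root. -/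
lemma exists_enum {V : Type*} [DecidableEq V] (f : V → V → ℝ) (m : ℕ) (S : Finset V)
    (hS : S.card = m + 1) :
    ∃ v : ℕ → V, (∀ i, v i ∈ S) ∧ (∀ i j, i < m + 1 → j < m + 1 → v i = v j → i = j) ∧
      ∀ i, 1 ≤ i → i + 1 < m + 1 → f (v i) (v 0) ≤ f (v (i + 1)) (v 0) := by
  obtain ⟨r, hr⟩ : S.Nonempty := Finset.card_pos.mp (by omega)
  have hT : (S.erase r).card = m := by rw [Finset.card_erase_of_mem hr]; omega
  let e := ((S.erase r).equivFinOfCardEq hT).symm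
  let g : Fin m → ℝ := fun i => f (e i) r
  let σ := Tuple.sort g
  have hσ : Monotone (g ∘ σ) := Tuple.monotone_sort g
  have hmem : ∀ i, (e i : V) ≠ r ∧ (e i : V) ∈ S := fun i => by
    have := (e i).2
    rwa [Finset.mem_erase] at this
  refine ⟨fun i => if h : 1 ≤ i ∧ i - 1 < m then (e (σ ⟨i - 1, h.2⟩) : V) else r, ?_, ?_, ?_⟩
  · intro i
    dsimp only
    split_ifs with h
    · exact (hmem _).2
    · exact hr
  · intro i j hi hj hij
    dsimp only at hij
    split_ifs at hij with h1 h2 h2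
    · have := σ.injective (e.injective (Subtype.ext hij))
      simp only [Fin.mk.injEq] at this
      omega
    · exact absurd hij (hmem _).1
    · exact absurd hij.symm (hmem _).1
    · omega
  · intro i h1 h2
    have a1 : 1 ≤ i ∧ i - 1 < m := by omega
    have a2 : 1 ≤ i + 1 ∧ i + 1 - 1 < m := by omega
    have a3 : ¬ (1 ≤ 0 ∧ 0 - 1 < m) := by omega
    simp only [dif_pos a1, dif_pos a2, dif_neg a3]
    exact hσ (show (⟨i - 1, a1.2⟩ : Fin m) ≤ ⟨i + 1 - 1, a2.2⟩ from by
      rw [Fin.mk_le_mk]; omega)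

lemma exists_cycle {V : Type*} [DecidableEq V] (w : V → V → ℝ)
    (hw : ∀ u v : V, u ≠ v → 0 < w u v) (m : ℕ) (S : Finset V)
    (hS : S.card = m + 1) (B : Finset ℝ) (hB : B.card < m) :
    ∃ (N : ℕ) (c : ℕ → V), IsDicycle (fun a b : V => a ≠ b) N c ∧ (∀ i, c i ∈ S) ∧
      ∑ i ∈ Finset.range N, w (c i) (c (i + 1)) ∉ B := by
  obtain ⟨v, hvS, hinj, hmono⟩ := exists_enum w m S hS
  let F : ℕ → ℝ := fun n => ∑ i ∈ Finset.range (n + 1), w (v i) (v (i + 1)) + w (v (n + 1)) (v 0)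
  have hstep : ∀ n, n + 1 < m → F n < F (n + 1) := by
    intro n hn
    have h1 := hmono (n + 1) (by omega) (by omega)
    have h2 : 0 < w (v (n + 1)) (v (n + 1 + 1)) := hw _ _ fun h => by
      have := hinj _ _ (by omega) (by omega) h
      omega
    simp only [F]
    rw [Finset.sum_range_succ _ (n + 1)]
    linarith
  have hlt : ∀ d n, n + d + 1 < m → F n < F (n + d + 1) := by
    intro d
    induction d with
    | zero => intro n hn; exact hstep n hn
    | succ d ih =>
      intro n hn
      exact (ih n (by omega)).trans (hstep _ hn)
  have hFinj : Set.InjOn F (Finset.range m : Set ℕ) := by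
    intro a ha b hb hab
    simp only [Finset.coe_range, Set.mem_Iio] at ha hb
    rcases lt_trichotomy a b with h | h | h
    · have := hlt (b - a - 1) a (by omega)
      rw [show a + (b - a - 1) + 1 = b by omega] at this
      exact absurd hab this.ne
    · exact h
    · have := hlt (a - b - 1) b (by omega)
      rw [show b + (a - b - 1) + 1 = a by omega] at this
      exact absurd hab.symm this.ne
  have hcard : ((Finset.range m).image F).card = m := by
    rw [Finset.card_image_of_injOn hFinj, Finset.card_range]
  obtain ⟨x, hx, hxB⟩ := Finset.exists_mem_notMem_of_card_lt_card (by omega : B.card < ((Finset.range m).image F).card)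
  obtain ⟨n, hn, rfl⟩ := Finset.mem_image.mp hx
  rw [Finset.mem_range] at hn
  refine ⟨n + 2, fun i => v (i % (n + 2)), ⟨by omega, ?_, ?_, ?_⟩, fun i => hvS _, ?_⟩
  · intro i h
    have l1 := Nat.mod_lt i (show n + 2 > 0 by omega)
    have l2 := Nat.mod_lt (i + 1) (show n + 2 > 0 by omega)
    have := hinj _ _ (by omega) (by omega) h
    rw [Nat.add_mod_eq_ite, Nat.mod_eq_of_lt (show 1 < n + 2 by omega)] at this
    split_ifs at this <;> omega
  · intro i
    simp
  · intro i j hi hj h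
    simp only [Nat.mod_eq_of_lt hi, Nat.mod_eq_of_lt hj] at h
    exact hinj _ _ (by omega) (by omega) h
  · have key : ∑ i ∈ Finset.range (n + 2), w (v (i % (n + 2))) (v ((i + 1) % (n + 2))) = F n := by
      rw [Finset.sum_range_succ]
      refine congrArg₂ (fun a b : ℝ => a + b) ?_ ?_
      · refine Finset.sum_congr rfl fun i hi => ?_
        rw [Finset.mem_range] at hi
        rw [Nat.mod_eq_of_lt (show i < n + 2 by omega),
          Nat.mod_eq_of_lt (show i + 1 < n + 2 by omega)]
      · rw [Nat.mod_eq_of_lt (show n + 1 < n + 2 by omega), Nat.mod_self]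
    dsimp only
    rw [key]
    exact hxB

lemma exists_cycles {V : Type*} [DecidableEq V] (w : V → V → ℝ)
    (hw : ∀ u v : V, u ≠ v → 0 < w u v) (k : ℕ) : ∀ (S : Finset V),
    2 * S.card = k ^ 2 + 3 * k →
    ∃ (N : Fin k → ℕ) (c : Fin k → ℕ → V),
      (∀ j, IsDicycle (fun a b : V => a ≠ b) (N j) (c j)) ∧
      (∀ j i, c j i ∈ S) ∧
      (∀ i j, i ≠ j → Disjoint (c i '' Set.Iio (N i)) (c j '' Set.Iio (N j))) ∧
      Function.Injective
        (fun j => ∑ i ∈ Finset.range (N j), w (c j i) (c j (i + 1))) := by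
  induction k with
  | zero =>
    intro S _
    exact ⟨fun _ => 0, fun j => j.elim0, fun j => j.elim0, fun j => j.elim0,
      fun j => j.elim0, fun j => j.elim0⟩
  | succ k ih =>
    intro S hS
    obtain ⟨T, hTS, hT⟩ := Finset.exists_subset_card_eq (show k + 2 ≤ S.card by nlinarith)
    have hd : (S \ T).card + (k + 2) = S.card := by
      rw [← hT]; exact Finset.card_sdiff_add_card_eq_card hTS
    obtain ⟨N, c, h1, h2, h3, h4⟩ := ih (S \ T) (by nlinarith)
    obtain ⟨N0, c0, g1, g2, g3⟩ := exists_cycle w hw (k + 1) T hT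
      (Finset.univ.image (fun j => ∑ i ∈ Finset.range (N j), w (c j i) (c j (i + 1))))
      (by
        refine lt_of_le_of_lt Finset.card_image_le ?_
        simp)
    have hdis : ∀ j, Disjoint (c0 '' Set.Iio N0) (c j '' Set.Iio (N j)) := by
      intro j
      rw [Set.disjoint_left]
      rintro _ ⟨a, _, rfl⟩ ⟨b, _, hb⟩
      have := h2 j b
      rw [hb, Finset.mem_sdiff] at this
      exact this.2 (g2 a)
    have hne : ∀ j, ∑ i ∈ Finset.range (N j), w (c j i) (c j (i + 1)) ≠
        ∑ i ∈ Finset.range N0, w (c0 i) (c0 (i + 1)) := fun j h =>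
      g3 (Finset.mem_image.mpr ⟨j, Finset.mem_univ _, h⟩)
    refine ⟨Fin.cons N0 N, Fin.cons c0 c, ?_, ?_, ?_, ?_⟩
    · intro j
      refine Fin.cases ?_ (fun j => ?_) j
      · simpa using g1
      · simpa using h1 j
    · intro j
      refine Fin.cases ?_ (fun j => ?_) j
      · intro i; simpa using hTS (g2 i)
      · intro i
        simpa using (Finset.mem_sdiff.mp (h2 j i)).1
    · intro i j
      refine Fin.cases ?_ (fun i => ?_) i <;> refine Fin.cases ?_ (fun j => ?_) j
      · intro h; exact absurd rfl h
      · intro _; simpa only [Fin.cons_zero, Fin.cons_succ] using hdis j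
      · intro _; simpa only [Fin.cons_zero, Fin.cons_succ] using (hdis i).symm
      · intro h
        simpa only [Fin.cons_zero, Fin.cons_succ] using h3 i j (fun e => h (by rw [e]))
    · intro i j
      refine Fin.cases ?_ (fun i => ?_) i <;> refine Fin.cases ?_ (fun j => ?_) j
      · intro _; rfl
      · intro h; simp only [Fin.cons_zero, Fin.cons_succ] at h; exact absurd h.symm (hne j)
      · intro h; simp only [Fin.cons_zero, Fin.cons_succ] at h; exact absurd h (hne i)
      · intro h
        simp only [Fin.cons_succ] at h
        rw [h4 h]

/-- Let `k ≥ 1` and `t = (k² + 3k)/2`.  For every positive arc-weighting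
`w` of the complete digraph on `t` vertices (arc relation `≠`), there exist `k`
pairwise vertex-disjoint directed cycles whose total weights are pairwise distinct. -/
theorem stmt6 {V : Type*} [Fintype V] (k : ℕ) (hk : 1 ≤ k)
    (hcard : Fintype.card V = (k ^ 2 + 3 * k) / 2)
    (w : V → V → ℝ) (hw : ∀ u v : V, u ≠ v → 0 < w u v) :
    ∃ (N : Fin k → ℕ) (c : Fin k → ℕ → V),
      (∀ j, IsDicycle (fun a b : V => a ≠ b) (N j) (c j)) ∧
      (∀ i j, i ≠ j → Disjoint (c i '' Set.Iio (N i)) (c j '' Set.Iio (N j))) ∧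
      Function.Injective
        (fun j => ∑ i ∈ Finset.range (N j), w (c j i) (c j (i + 1))) := by
  classical
  have h2 : 2 * (Finset.univ : Finset V).card = k ^ 2 + 3 * k := by
    rw [Finset.card_univ, hcard]
    have : Even (k ^ 2 + 3 * k) := by
      rw [show k ^ 2 + 3 * k = k * (k + 1) + 2 * k by ring]
      exact (Nat.even_mul_succ_self k).add (even_two_mul k)
    exact Nat.two_mul_div_two_of_even this
  obtain ⟨N, c, a1, _, a3, a4⟩ := exists_cycles w hw k Finset.univ h2
  exact ⟨N, c, a1, a3, a4⟩
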